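/- arXiv:1807.04882 — 2 statements merged into one kernel-verified Lean document; each statement's English description precedes it below -/
import Mathlib

section
/- Let (b, f, G) and (b̂, f̂, Ĝ) be two triples, each consisting of a drift coefficient, a running cost and a terminal cost with the same constant L, and let Φ, Φ̂ be the corresponding pathwise costs. Suppose δβ(s) := sup_{x ∈ ℝ^d} |b(s,x) − b̂(s,x)| and δf(s) := sup_{x ∈ ℝ^d} |f(s,x) − f̂(s,x)| are Lebesgue-measurable in s, and set δG := sup_{x ∈ ℝ^d} |G(x) − Ĝ(x)|. Then for every (t,x) ∈ [0,T] × ℝ^d, |Φ(t,x) − Φ̂(t,x)| ≤ δG + ∫_t^T δf(s) ds + L(T+1)e^{LT} ∫_t^T δβ(s) ds (the key pathwise estimate behind Lemma 4.2). -/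
open MeasureTheory Set

noncomputable section

/-- The Euclidean state space `ℝ^d`. -/
abbrev E (d : ℕ) := EuclideanSpace ℝ (Fin d)

/-- A drift coefficient: `t ↦ b(t,x)` is Lebesgue-measurable for each `x`, and for a.e.
`t ∈ [0,T]`, `|b(t,x)| ≤ L` and `|b(t,x) − b(t,y)| ≤ L|x − y|` for all `x, y`. -/
def IsDrift (d : ℕ) (T L : ℝ) (b : ℝ → E d → E d) : Prop :=
  (∀ x : E d, Measurable fun t => b t x) ∧
  ∀ᵐ t ∂(volume.restrict (Icc (0 : ℝ) T)),
    (∀ x : E d, ‖b t x‖ ≤ L) ∧ ∀ x y : E d, ‖b t x - b t y‖ ≤ L * ‖x - y‖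

/-- `X` is a state trajectory for the drift `b` started at `(r, ξ)`: it is continuous on
`[r,T]` and satisfies `X_t = ξ + ∫_r^t b(s, X_s) ds` for all `t ∈ [r,T]`. -/
def IsTraj (d : ℕ) (T : ℝ) (b : ℝ → E d → E d) (r : ℝ) (ξ : E d) (X : ℝ → E d) : Prop :=
  ContinuousOn X (Icc r T) ∧ ∀ t ∈ Icc r T, X t = ξ + ∫ s in r..t, b s (X s)

/-- A running cost: `t ↦ f(t,x)` is Lebesgue-measurable for each `x`, and for a.e.
`t ∈ [0,T]`, `|f(t,x)| ≤ L` and `|f(t,x) − f(t,y)| ≤ L|x − y|` for all `x, y`. -/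
def IsRunningCost (d : ℕ) (T L : ℝ) (f : ℝ → E d → ℝ) : Prop :=
  (∀ x : E d, Measurable fun t => f t x) ∧
  ∀ᵐ t ∂(volume.restrict (Icc (0 : ℝ) T)),
    (∀ x : E d, |f t x| ≤ L) ∧ ∀ x y : E d, |f t x - f t y| ≤ L * ‖x - y‖

/-- A terminal cost: `|G(x)| ≤ L` and `|G(x) − G(y)| ≤ L|x − y|` for all `x, y`. -/
def IsTerminalCost (d : ℕ) (L : ℝ) (G : E d → ℝ) : Prop :=
  (∀ x : E d, |G x| ≤ L) ∧ ∀ x y : E d, |G x - G y| ≤ L * ‖x - y‖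

/-- A Carathéodory integrand which is bounded and Lipschitz in space for almost every time is
integrable along any measurable path. -/
theorem integrable_caratheodory_comp {V H : Type*} [NormedAddCommGroup V]
    [MeasurableSpace V] [BorelSpace V] [SecondCountableTopology V] [NormedAddCommGroup H]
    [MeasurableSpace H] [BorelSpace H] [SecondCountableTopology H]
    {μ : Measure ℝ} [IsFiniteMeasure μ] {L : ℝ} {F : ℝ → V → H}
    (hm : ∀ x, Measurable fun t => F t x)
    (hF : ∀ᵐ t ∂μ, (∀ x, ‖F t x‖ ≤ L) ∧ ∀ x y, ‖F t x - F t y‖ ≤ L * ‖x - y‖)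
    {X : ℝ → V} (hX : AEMeasurable X μ) : Integrable (fun s => F s (X s)) μ := by
  obtain ⟨S, hSsub, hS, hSμ⟩ := exists_measurable_superset_of_null (ae_iff.1 hF)
  have hgood : ∀ t, t ∉ S → (∀ x, ‖F t x‖ ≤ L) ∧ ∀ x y, ‖F t x - F t y‖ ≤ L * ‖x - y‖ := by
    intro t ht
    by_contra h
    exact ht (hSsub h)
  have hcont : ∀ t, Continuous fun x => Sᶜ.indicator (fun t => F t x) t := by
    intro t
    by_cases ht : t ∈ S
    · simp [ht, continuous_const]
    · simp only [indicator_of_mem (mem_compl ht)]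
      refine (LipschitzWith.of_dist_le' (K := L) fun x y => ?_).continuous
      simpa only [dist_eq_norm] using (hgood t ht).2 x y
  have hunc := measurable_uncurry_of_continuous_of_measurable
    (u := fun x t => Sᶜ.indicator (fun t => F t x) t) hcont
    fun x => (hm x).indicator hS.compl
  have hae : ∀ᵐ t ∂μ, t ∉ S := measure_eq_zero_iff_ae_notMem.1 hSμ
  have hmeas : AEMeasurable (fun s => F s (X s)) μ := by
    refine (hunc.comp_aemeasurable (hX.prodMk aemeasurable_id)).congr ?_
    filter_upwards [hae] with t ht
    simp [Function.uncurry, ht]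
  refine Integrable.of_bound hmeas.aestronglyMeasurable L ?_
  filter_upwards [hF] with t ht using ht.1 _

/-- Grönwall's inequality in integral form, with a constant forcing term. -/
theorem le_mul_exp_of_le_add_mul_integral {u : ℝ → ℝ} {a b B L : ℝ} (hL : 0 ≤ L)
    (hu : ContinuousOn u (Icc a b))
    (h : ∀ s ∈ Icc a b, u s ≤ B + L * ∫ r in a..s, u r) :
    ∀ s ∈ Icc a b, u s ≤ B * Real.exp (L * (s - a)) := by
  intro s hs
  have hab : a ≤ b := hs.1.trans hs.2
  set w : ℝ → ℝ := IccExtend hab ((Icc a b).domRestrict u) with hw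
  have hwc : Continuous w := (continuousOn_iff_continuous_domRestrict.1 hu).Icc_extend'
  have hwu : ∀ r ∈ Icc a b, w r = u r := fun r hr => by
    rw [hw, IccExtend_of_mem hab _ hr]; rfl
  have hint : ∀ s ∈ Icc a b, ∫ r in a..s, u r = ∫ r in a..s, w r := fun s hs =>
    intervalIntegral.integral_congr fun r hr => by
      rw [uIcc_of_le hs.1] at hr
      exact (hwu r ⟨hr.1, hr.2.trans hs.2⟩).symm
  have hder : ∀ r, HasDerivAt (fun s => B + L * ∫ r in a..s, w r) (L * w r) r := fun r =>
    ((hwc.integral_hasStrictDerivAt a r).hasDerivAt.const_mul L).const_add B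
  have key := le_gronwallBound_of_liminf_deriv_right_le (f := fun s => B + L * ∫ r in a..s, w r)
    (f' := fun r => L * w r) (δ := B) (K := L) (ε := 0) (a := a) (b := b)
    (fun r _ => (hder r).continuousAt.continuousWithinAt)
    (fun r _ _ hr => (hder r).hasDerivWithinAt.liminf_right_slope_le hr) (by simp)
    (fun r hr => by
      have hr' := Ico_subset_Icc_self hr
      have := h r hr'
      rw [hint r hr', ← hwu r hr'] at this
      simpa using mul_le_mul_of_nonneg_left this hL) s hs
  rw [gronwallBound_ε0] at key
  have := h s hs
  rw [hint s hs] at this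
  exact this.trans key

/-- If two functions are bounded by `L`, their difference is pointwise bounded by its supremum. -/
theorem norm_sub_le_iSup_of_norm_le {V H : Type*} [SeminormedAddCommGroup H] {L : ℝ} {g g' : V → H}
    (hg : ∀ x, ‖g x‖ ≤ L) (hg' : ∀ x, ‖g' x‖ ≤ L) (x : V) :
    ‖g x - g' x‖ ≤ ⨆ y, ‖g y - g' y‖ :=
  le_ciSup (f := fun y => ‖g y - g' y‖)
    ⟨L + L, by rintro _ ⟨y, rfl⟩; exact (norm_sub_le _ _).trans (add_le_add (hg y) (hg' y))⟩ x

/-- The uniform distance `δ` of two bounded Lipschitz coefficients is integrable, and it controls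
the difference of their values at two points for almost every time. -/
theorem integrable_iSup_norm_sub {V H : Type*} [SeminormedAddCommGroup V]
    [SeminormedAddCommGroup H] {μ : Measure ℝ} [IsFiniteMeasure μ] {L : ℝ} {F F' : ℝ → V → H}
    (hF : ∀ᵐ t ∂μ, (∀ x, ‖F t x‖ ≤ L) ∧ ∀ x y, ‖F t x - F t y‖ ≤ L * ‖x - y‖)
    (hF' : ∀ᵐ t ∂μ, (∀ x, ‖F' t x‖ ≤ L) ∧ ∀ x y, ‖F' t x - F' t y‖ ≤ L * ‖x - y‖)
    {δ : ℝ → ℝ} (hδ : ∀ s, δ s = ⨆ x, ‖F s x - F' s x‖) (hδm : Measurable δ) :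
    Integrable δ μ ∧ ∀ᵐ s ∂μ, ∀ x y, ‖F s x - F' s y‖ ≤ δ s + L * ‖x - y‖ := by
  constructor
  · refine Integrable.of_bound hδm.aestronglyMeasurable (L + L) ?_
    filter_upwards [hF, hF'] with s h h'
    rw [hδ, Real.norm_of_nonneg (Real.iSup_nonneg fun _ => norm_nonneg _)]
    exact ciSup_le fun y => (norm_sub_le _ _).trans (add_le_add (h.1 y) (h'.1 y))
  · filter_upwards [hF, hF'] with s h h' x y
    rw [hδ]
    calc ‖F s x - F' s y‖ = ‖(F s y - F' s y) + (F s x - F s y)‖ := by congr 1; abel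
      _ ≤ _ := (norm_add_le _ _).trans
        (add_le_add (norm_sub_le_iSup_of_norm_le h.1 h'.1 y) (h.2 x y))

/-- Two paths driven by bounded Lipschitz coefficients have integrated difference controlled by the
uniform distance of the coefficients and the distance of the paths. -/
theorem norm_integral_sub_integral_le {V H : Type*} [NormedAddCommGroup V]
    [MeasurableSpace V] [BorelSpace V] [SecondCountableTopology V]
    [NormedAddCommGroup H] [NormedSpace ℝ H]
    [MeasurableSpace H] [BorelSpace H] [SecondCountableTopology H]
    {L a c : ℝ} (hac : a ≤ c) {F F' : ℝ → V → H}
    (hm : ∀ x, Measurable fun t => F t x) (hm' : ∀ x, Measurable fun t => F' t x)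
    (hF : ∀ᵐ t ∂(volume.restrict (Icc a c)),
      (∀ x, ‖F t x‖ ≤ L) ∧ ∀ x y, ‖F t x - F t y‖ ≤ L * ‖x - y‖)
    (hF' : ∀ᵐ t ∂(volume.restrict (Icc a c)),
      (∀ x, ‖F' t x‖ ≤ L) ∧ ∀ x y, ‖F' t x - F' t y‖ ≤ L * ‖x - y‖)
    {δ : ℝ → ℝ} (hδ : ∀ s, δ s = ⨆ x, ‖F s x - F' s x‖) (hδm : Measurable δ)
    {X X' : ℝ → V} (hX : ContinuousOn X (Icc a c)) (hX' : ContinuousOn X' (Icc a c)) :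
    ‖(∫ s in a..c, F s (X s)) - ∫ s in a..c, F' s (X' s)‖ ≤
      (∫ s in a..c, δ s) + L * ∫ s in a..c, ‖X s - X' s‖ := by
  obtain ⟨hδi, hle⟩ := integrable_iSup_norm_sub hF hF' hδ hδm
  have hu : IntervalIntegrable (fun s => ‖X s - X' s‖) volume a c :=
    (hX.sub hX').norm.intervalIntegrable_of_Icc hac
  have hδI : IntervalIntegrable δ volume a c :=
    (intervalIntegrable_iff_integrableOn_Icc_of_le hac).2 hδi
  rw [← intervalIntegral.integral_sub
      ((intervalIntegrable_iff_integrableOn_Icc_of_le hac).2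
        (integrable_caratheodory_comp hm hF (hX.aemeasurable measurableSet_Icc)))
      ((intervalIntegrable_iff_integrableOn_Icc_of_le hac).2
        (integrable_caratheodory_comp hm' hF' (hX'.aemeasurable measurableSet_Icc))),
    ← intervalIntegral.integral_const_mul, ← intervalIntegral.integral_add hδI (hu.const_mul L)]
  refine intervalIntegral.norm_integral_le_of_norm_le hac ?_ (hδI.add (hu.const_mul L))
  have hle' := (ae_restrict_iff' measurableSet_Icc).1 hle
  filter_upwards [hle'] with s hs hsI using hs (Ioc_subset_Icc_self hsI) _ _

/-- Key pathwise estimate behind Lemma 4.2: for two coefficient triples `(b,f,G)` and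
`(b̂,f̂,Ĝ)` with the same constant `L`, with `δβ(s) = sup_x |b(s,x) − b̂(s,x)|`,
`δf(s) = sup_x |f(s,x) − f̂(s,x)|` (assumed measurable) and `δG = sup_x |G(x) − Ĝ(x)|`,
the pathwise costs satisfy
`|Φ(t,x) − Φ̂(t,x)| ≤ δG + ∫_t^T δf(s) ds + L(T+1)e^{LT} ∫_t^T δβ(s) ds`. -/
theorem pathwise_cost_coefficient_stability
    (d : ℕ) (hd : 1 ≤ d) (T L : ℝ) (hT : 0 < T) (hL : 0 < L)
    (b b' : ℝ → E d → E d) (hb : IsDrift d T L b) (hb' : IsDrift d T L b')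
    (f f' : ℝ → E d → ℝ) (hf : IsRunningCost d T L f) (hf' : IsRunningCost d T L f')
    (G G' : E d → ℝ) (hG : IsTerminalCost d L G) (hG' : IsTerminalCost d L G')
    (δβ δf : ℝ → ℝ) (δG : ℝ)
    (hδβ : ∀ s, δβ s = ⨆ x : E d, ‖b s x - b' s x‖) (hδβm : Measurable δβ)
    (hδf : ∀ s, δf s = ⨆ x : E d, |f s x - f' s x|) (hδfm : Measurable δf)
    (hδG : δG = ⨆ x : E d, |G x - G' x|)
    (t : ℝ) (ht : t ∈ Icc (0 : ℝ) T) (x : E d)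
    (X X' : ℝ → E d) (hX : IsTraj d T b t x X) (hX' : IsTraj d T b' t x X') :
    |((∫ s in t..T, f s (X s)) + G (X T)) - ((∫ s in t..T, f' s (X' s)) + G' (X' T))| ≤
      δG + (∫ s in t..T, δf s) +
        L * (T + 1) * Real.exp (L * T) * ∫ s in t..T, δβ s := by
  have hsub : ∀ s ∈ Icc t T, Icc t s ⊆ Icc 0 T := fun s hs => Icc_subset_Icc ht.1 hs.2
  have hres : ∀ s ∈ Icc t T, ∀ {p : ℝ → Prop}, (∀ᵐ r ∂(volume.restrict (Icc (0 : ℝ) T)), p r) →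
      ∀ᵐ r ∂(volume.restrict (Icc t s)), p r := fun s hs _ h =>
    ae_restrict_of_ae_restrict_of_subset (hsub s hs) h
  have hTT : T ∈ Icc t T := ⟨ht.2, le_rfl⟩
  set B := ∫ s in t..T, δβ s with hB
  have hδβ0 : ∀ s, 0 ≤ δβ s := fun s => by
    rw [hδβ]; exact Real.iSup_nonneg fun _ => norm_nonneg _
  have hB0 : 0 ≤ B := intervalIntegral.integral_nonneg ht.2 fun s _ => hδβ0 s
  have hu : ContinuousOn (fun s => ‖X s - X' s‖) (Icc t T) := (hX.1.sub hX'.1).norm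
  have hgron : ∀ s ∈ Icc t T, ‖X s - X' s‖ ≤ B + L * ∫ r in t..s, ‖X r - X' r‖ := by
    intro s hs
    have hmono : Icc t s ⊆ Icc t T := Icc_subset_Icc_right hs.2
    rw [hX.2 s hs, hX'.2 s hs, add_sub_add_left_eq_sub]
    refine (norm_integral_sub_integral_le hs.1 hb.1 hb'.1 (hres s hs hb.2) (hres s hs hb'.2)
      hδβ hδβm (hX.1.mono hmono) (hX'.1.mono hmono)).trans (add_le_add_left ?_ _)
    refine intervalIntegral.integral_mono_interval le_rfl hs.1 hs.2
      (Filter.Eventually.of_forall hδβ0) ?_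
    exact (intervalIntegrable_iff_integrableOn_Icc_of_le ht.2).2
      (integrable_iSup_norm_sub (hres T hTT hb.2) (hres T hTT hb'.2) hδβ hδβm).1
  have hbound : ∀ s ∈ Icc t T, ‖X s - X' s‖ ≤ B * Real.exp (L * T) := fun s hs =>
    (le_mul_exp_of_le_add_mul_integral hL.le hu hgron s hs).trans <| by
      gcongr
      linarith [hs.2, ht.1]
  have hf₁ := norm_integral_sub_integral_le ht.2 hf.1 hf'.1 (hres T hTT hf.2) (hres T hTT hf'.2)
    hδf hδfm hX.1 hX'.1
  have hint : ∫ s in t..T, ‖X s - X' s‖ ≤ T * (B * Real.exp (L * T)) := by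
    calc ∫ s in t..T, ‖X s - X' s‖ ≤ ∫ _ in t..T, B * Real.exp (L * T) :=
          intervalIntegral.integral_mono_on ht.2 (hu.intervalIntegrable_of_Icc ht.2)
            intervalIntegrable_const hbound
      _ = (T - t) * (B * Real.exp (L * T)) := by
          rw [intervalIntegral.integral_const, smul_eq_mul]
      _ ≤ T * (B * Real.exp (L * T)) := by
          gcongr
          linarith [ht.1]
  have hG₁ : |G (X T) - G' (X' T)| ≤ δG + L * (B * Real.exp (L * T)) := by
    calc |G (X T) - G' (X' T)|
        ≤ |G (X' T) - G' (X' T)| + |G (X T) - G (X' T)| := by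
          rw [add_comm]; exact abs_sub_le _ _ _
      _ ≤ δG + L * (B * Real.exp (L * T)) := by
          refine add_le_add ?_ ((hG.2 _ _).trans ?_)
          · rw [hδG]
            exact norm_sub_le_iSup_of_norm_le (g := G) (g' := G') hG.1 hG'.1 (X' T)
          · exact mul_le_mul_of_nonneg_left (hbound T hTT) hL.le
  calc _ = |((∫ s in t..T, f s (X s)) - ∫ s in t..T, f' s (X' s)) + (G (X T) - G' (X' T))| := by
        congr 1; ring
    _ ≤ _ := abs_add_le _ _
    _ ≤ ((∫ s in t..T, δf s) + L * (T * (B * Real.exp (L * T)))) +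
          (δG + L * (B * Real.exp (L * T))) :=
        add_le_add (hf₁.trans (by gcongr)) hG₁
    _ = _ := by ring
end
end

section
/- The penalty function h satisfies h(0) = 0 and h(x) > 0 for every x ∈ ℝ^d with |x| > 0. -/
open MeasureTheory Set

noncomputable section

/-- The unnormalized standard bump: `exp(1/(|x|² − 1))` for `|x| < 1` and `0` otherwise. -/
def bump (d : ℕ) (x : E d) : ℝ :=
  if ‖x‖ < 1 then Real.exp (1 / (‖x‖ ^ 2 - 1)) else 0

/-- The normalizing constant `c̃ = (∫_{|x|<1} exp(1/(|x|²−1)) dx)⁻¹`; since `bump` vanishes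
outside the unit ball, the integral may be taken over all of `ℝ^d`. -/
def ctilde (d : ℕ) : ℝ := (∫ x : E d, bump d x)⁻¹

/-- The standard bump function `ρ` with `∫ ρ = 1`. -/
def rho (d : ℕ) (x : E d) : ℝ := ctilde d * bump d x

/-- The penalty function `h(x) = ∫_{ℝ^d} 1_{|y|>1} (|y| − 1) ρ(x − y) dy`. -/
def pen (d : ℕ) (x : E d) : ℝ :=
  ∫ y : E d, (if 1 < ‖y‖ then ‖y‖ - 1 else 0) * rho d (x - y)

theorem bump_nonneg (d : ℕ) (x : E d) : 0 ≤ bump d x := by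
  unfold bump
  split_ifs <;> positivity

theorem bump_pos_iff (d : ℕ) (x : E d) : 0 < bump d x ↔ ‖x‖ < 1 := by
  unfold bump
  split_ifs with h <;> simp [h, Real.exp_pos]

theorem bump_le_one (d : ℕ) (x : E d) : bump d x ≤ 1 := by
  unfold bump
  split_ifs with h
  · refine Real.exp_le_one_iff.mpr (one_div_nonpos.mpr ?_)
    nlinarith [norm_nonneg x]
  · exact zero_le_one

theorem bump_eq_zero (d : ℕ) {x : E d} (hx : 1 ≤ ‖x‖) : bump d x = 0 := by
  simp [bump, not_lt.mpr hx]

theorem measurable_bump (d : ℕ) : Measurable (bump d) := by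
  unfold bump
  exact Measurable.ite (measurableSet_lt measurable_norm measurable_const)
    (by fun_prop) measurable_const

theorem integrable_indicator_ball (d : ℕ) (x : E d) (r C : ℝ) :
    Integrable ((Metric.ball x r).indicator fun _ => C) :=
  (integrable_indicator_iff Metric.isOpen_ball.measurableSet).mpr
    (integrableOn_const measure_ball_lt_top.ne)

theorem integrable_bump (d : ℕ) : Integrable (bump d) := by
  refine (integrable_indicator_ball d 0 1 1).mono' (measurable_bump d).aestronglyMeasurable
    (ae_of_all _ fun x => ?_)
  rw [Real.norm_of_nonneg (bump_nonneg d x)]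
  by_cases hx : ‖x‖ < 1
  · simpa [indicator, hx] using bump_le_one d x
  · simp [indicator, hx, bump_eq_zero d (not_lt.mp hx)]

theorem ctilde_pos (d : ℕ) : 0 < ctilde d := by
  refine inv_pos.mpr ((integral_pos_iff_support_of_nonneg (bump_nonneg d)
    (integrable_bump d)).mpr ?_)
  refine (Metric.measure_ball_pos volume (0 : E d) one_pos).trans_le (measure_mono fun x hx => ?_)
  exact ((bump_pos_iff d x).mpr (by simpa using hx)).ne'

theorem rho_nonneg (d : ℕ) (x : E d) : 0 ≤ rho d x :=
  mul_nonneg (ctilde_pos d).le (bump_nonneg d x)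

theorem pen_integrand_nonneg (d : ℕ) (x y : E d) :
    0 ≤ (if 1 < ‖y‖ then ‖y‖ - 1 else 0) * rho d (x - y) := by
  refine mul_nonneg ?_ (rho_nonneg d _)
  split_ifs with h
  · linarith
  · exact le_rfl

theorem integrable_pen_integrand (d : ℕ) (x : E d) :
    Integrable fun y : E d => (if 1 < ‖y‖ then ‖y‖ - 1 else 0) * rho d (x - y) := by
  refine (integrable_indicator_ball d x 1 (‖x‖ * ctilde d)).mono'
    (Measurable.aestronglyMeasurable ?_) (ae_of_all _ fun y => ?_)
  · refine Measurable.mul (Measurable.ite (measurableSet_lt measurable_const measurable_norm)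
      (by fun_prop) measurable_const) ?_
    exact ((measurable_bump d).comp (measurable_const.sub measurable_id)).const_mul _
  · rw [Real.norm_of_nonneg (pen_integrand_nonneg d x y)]
    by_cases hy : ‖x - y‖ < 1
    · have hball : y ∈ Metric.ball x 1 := by rwa [Metric.mem_ball, dist_comm, dist_eq_norm]
      rw [indicator_of_mem hball]
      refine mul_le_mul ?_ (mul_le_of_le_one_right (ctilde_pos d).le (bump_le_one d _))
        (rho_nonneg d _) (norm_nonneg x)
      split_ifs
      · linarith [norm_sub_norm_le y x, norm_sub_rev x y]
      · exact norm_nonneg x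
    · have hball : y ∉ Metric.ball x 1 := by rwa [Metric.mem_ball, dist_comm, dist_eq_norm]
      rw [indicator_of_notMem hball, rho, bump_eq_zero d (not_lt.mp hy)]
      simp

theorem exists_one_lt_norm_norm_sub_lt_one {F : Type*} [NormedAddCommGroup F] [NormedSpace ℝ F]
    {x : F} (hx : 0 < ‖x‖) : ∃ y : F, 1 < ‖y‖ ∧ ‖x - y‖ < 1 := by
  set r := ‖x‖ with hr
  have hs : 0 < 1 / (r * (1 + r)) := by positivity
  refine ⟨(1 + 1 / (r * (1 + r))) • x, ?_, ?_⟩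
  · rw [norm_smul, Real.norm_of_nonneg (by positivity), ← hr]
    have : (1 + 1 / (r * (1 + r))) * r = 1 + r ^ 2 / (1 + r) := by
      field_simp
      ring
    rw [this]
    exact lt_add_of_pos_right _ (by positivity)
  · have : x - (1 + 1 / (r * (1 + r))) • x = -((1 / (r * (1 + r))) • x) := by module
    rw [this, norm_neg, norm_smul, Real.norm_of_nonneg hs.le, ← hr, div_mul_eq_mul_div,
      div_lt_one (by positivity)]
    nlinarith

/-- The penalty function satisfies `h(0) = 0` and `h(x) > 0` whenever `|x| > 0`. -/
theorem pen_zero_and_pos (d : ℕ) (hd : 1 ≤ d) :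
    pen d 0 = 0 ∧ ∀ x : E d, 0 < ‖x‖ → 0 < pen d x := by
  constructor
  · refine integral_eq_zero_of_ae (ae_of_all _ fun y => ?_)
    by_cases hy : 1 < ‖y‖
    · simp [rho, bump_eq_zero d (x := -y) (by simpa using hy.le)]
    · simp [hy]
  · intro x hx
    refine (integral_pos_iff_support_of_nonneg (pen_integrand_nonneg d x)
      (integrable_pen_integrand d x)).mpr ?_
    have hopen : IsOpen {y : E d | 1 < ‖y‖ ∧ ‖x - y‖ < 1} :=
      (isOpen_lt continuous_const continuous_norm).inter
        (isOpen_lt (continuous_const.sub continuous_id).norm continuous_const)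
    refine (hopen.measure_pos volume (exists_one_lt_norm_norm_sub_lt_one hx)).trans_le
      (measure_mono fun y hy => ?_)
    have hbump := (bump_pos_iff d (x - y)).mpr hy.2
    simp only [Function.mem_support, if_pos hy.1]
    exact (mul_pos (sub_pos.mpr hy.1) (mul_pos (ctilde_pos d) hbump)).ne'
end
end
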